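/- Let A be a unital C*-algebra and let (A_i)_{i∈I} be a family of C*-subalgebras of A, each containing the unit of A, that is directed under inclusion and whose union is dense in A. If f is a state on A whose restriction to each A_i is a pure state of A_i, then f is a pure state of A. -/

import Mathlib

open scoped ComplexOrder

/-- A positive linear functional on a unital C*-algebra (or a unital C*-subalgebra). -/
def IsPosFunctional {A : Type*} [CStarAlgebra A] (f : A →ₗ[ℂ] ℂ) : Prop :=
  ∀ a : A, 0 ≤ f (star a * a)

/-- A state on a unital C*-algebra: a positive linear functional sending `1` to `1`. -/
def IsState {A : Type*} [CStarAlgebra A] (f : A →ₗ[ℂ] ℂ) : Prop :=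
  IsPosFunctional f ∧ f 1 = 1

/-- A pure state: a state such that every positive linear functional it dominates is a
nonnegative scalar multiple of it. -/
def IsPureState {A : Type*} [CStarAlgebra A] (f : A →ₗ[ℂ] ℂ) : Prop :=
  IsState f ∧ ∀ g : A →ₗ[ℂ] ℂ, IsPosFunctional g → IsPosFunctional (f - g) →
    ∃ t : ℝ, 0 ≤ t ∧ g = (t : ℂ) • f

/-- The restriction of a linear functional to a (star) subalgebra. -/
noncomputable def restrictFunctional {A : Type*} [CStarAlgebra A] (f : A →ₗ[ℂ] ℂ)
    (S : StarSubalgebra ℂ A) : ↥S →ₗ[ℂ] ℂ :=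
  { toFun := fun x => f (x : A)
    map_add' := by intro x y; simp
    map_smul' := by intro c x; simp }

/-- Positivity of a linear functional on a star subalgebra of a unital C*-algebra. -/
def IsPosFunctionalOn {A : Type*} [CStarAlgebra A] (S : StarSubalgebra ℂ A)
    (g : ↥S →ₗ[ℂ] ℂ) : Prop :=
  ∀ a : ↥S, 0 ≤ g (star a * a)

/-- A pure state on a star subalgebra of a unital C*-algebra. -/
def IsPureStateOn {A : Type*} [CStarAlgebra A] (S : StarSubalgebra ℂ A)
    (h : ↥S →ₗ[ℂ] ℂ) : Prop :=
  (IsPosFunctionalOn S h ∧ h 1 = 1) ∧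
    ∀ g : ↥S →ₗ[ℂ] ℂ, IsPosFunctionalOn S g → IsPosFunctionalOn S (h - g) →
      ∃ t : ℝ, 0 ≤ t ∧ g = (t : ℂ) • h

/-- A positive linear functional on a unital C*-algebra is automatically continuous. -/
theorem IsPosFunctional.continuous {A : Type*} [CStarAlgebra A] {g : A →ₗ[ℂ] ℂ}
    (hg : IsPosFunctional g) : Continuous g := by
  let _ := CStarAlgebra.spectralOrder A
  have _ := CStarAlgebra.spectralOrderedRing A
  let gPos : A →ₚ[ℂ] ℂ := PositiveLinearMap.mk₀ g fun x hx => by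
    obtain ⟨a, rfl⟩ := CStarAlgebra.nonneg_iff_eq_star_mul_self.mp hx
    exact hg a
  exact map_continuous gPos

/-- A positive functional dominated by `f` agrees with `g 1 • f` on every unital star subalgebra
on which `f` restricts to a pure state. -/
theorem IsPureStateOn.apply_eq {A : Type*} [CStarAlgebra A] {S : StarSubalgebra ℂ A}
    {f g : A →ₗ[ℂ] ℂ} (hS : IsPureStateOn S (restrictFunctional f S))
    (hg : IsPosFunctional g) (hfg : IsPosFunctional (f - g)) {a : A} (ha : a ∈ S) :
    g a = g 1 * f a := by
  obtain ⟨t, -, ht⟩ := hS.2 (restrictFunctional g S) (fun a => hg a) (fun a => hfg a)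
  have apply_eq (x : S) : g x = t * f x := LinearMap.congr_fun ht x
  have hf1 : f 1 = 1 := hS.1.2
  have hg1 : g 1 = t := by simpa [hf1] using apply_eq 1
  rw [hg1]
  exact apply_eq ⟨a, ha⟩

/-- If `(A i)` is a family of unital C*-subalgebras of `A`, directed under inclusion, whose
union is dense in `A`, and `f` is a state on `A` whose restriction to each `A i` is pure,
then `f` is a pure state of `A`. -/
theorem pure_of_pure_on_directed_dense_union
    {A : Type*} [CStarAlgebra A] {ι : Type*} (S : ι → StarSubalgebra ℂ A)
    (hclosed : ∀ i, IsClosed (S i : Set A))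
    (hdir : ∀ i j, ∃ k, S i ≤ S k ∧ S j ≤ S k)
    (hdense : Dense (⋃ i, (S i : Set A)))
    (f : A →ₗ[ℂ] ℂ) (hf : IsState f)
    (hpure : ∀ i, IsPureStateOn (S i) (restrictFunctional f (S i))) :
    IsPureState f := by
  refine ⟨hf, fun g hg hfg => ?_⟩
  have g_one_nonneg : 0 ≤ g 1 := by simpa using hg 1
  obtain ⟨t, ht, htg⟩ : ∃ t : ℝ, 0 ≤ t ∧ (t : ℂ) = g 1 :=
    RCLike.nonneg_iff_exists_ofReal.mp g_one_nonneg
  refine ⟨t, ht, DFunLike.coe_injective ?_⟩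
  refine hg.continuous.ext_on hdense (hf.1.continuous.const_smul (t : ℂ)) fun a ha => ?_
  obtain ⟨i, hi⟩ := Set.mem_iUnion.mp ha
  simpa [htg] using (hpure i).apply_eq hg hfg hi
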